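/- arXiv:2107.08461 — 2 statements merged into one kernel-verified Lean document; each statement's English description precedes it below -/
import Mathlib

section
/- Monotonicity of the GDP privacy-loss function: For all positive reals T and K, the function f : (0,∞) → ℝ given by f(x) = x·√(T·(exp(K/x²) − 1)) is antitone (monotonically nonincreasing) on (0,∞). -/
/-- The secant slope `(exp u - 1) / u` of the exponential at the origin is monotone on `(0, ∞)`. -/
theorem monotoneOn_exp_sub_one_div :
    MonotoneOn (fun u : ℝ => (Real.exp u - 1) / u) (Set.Ioi 0) := by
  intro u hu v hv huv
  have h := convexOn_exp.secant_mono (Set.mem_univ 0) (Set.mem_univ u) (Set.mem_univ v)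
    (ne_of_gt hu) (ne_of_gt hv) huv
  simpa using h

/-- Monotonicity of the GDP privacy-loss function: for positive `T` and `K`,
`x ↦ x·√(T·(exp(K/x²) − 1))` is antitone on `(0, ∞)`. -/
theorem gdp_loss_antitone (T K : ℝ) (hT : 0 < T) (hK : 0 < K) :
    AntitoneOn (fun x : ℝ => x * Real.sqrt (T * (Real.exp (K / x ^ 2) - 1)))
      (Set.Ioi (0 : ℝ)) := by
  have sqrt_form : ∀ x : ℝ, 0 < x → x * Real.sqrt (T * (Real.exp (K / x ^ 2) - 1)) =
      Real.sqrt (T * K * ((Real.exp (K / x ^ 2) - 1) / (K / x ^ 2))) := by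
    intro x hx
    nth_rewrite 1 [← Real.sqrt_sq hx.le]
    rw [← Real.sqrt_mul (sq_nonneg x)]
    congr 1
    field_simp
  intro x (hx : 0 < x) y (hy : 0 < y) hxy
  simp only [sqrt_form x hx, sqrt_form y hy]
  have hle : K / y ^ 2 ≤ K / x ^ 2 := by gcongr
  exact Real.sqrt_le_sqrt (mul_le_mul_of_nonneg_left
    (monotoneOn_exp_sub_one_div (Set.mem_Ioi.2 (by positivity)) (Set.mem_Ioi.2 (by positivity)) hle)
    (by positivity))
end

section
/- Larger batch size is more private for DP-SGLD: For all fixed positive reals T, n, C, η, the map b ↦ √(T·(exp(n²·C²/(η·b²)) − 1))·b/n, which sends the batch size b to the GDP parameter of DP-SGLD, is antitone (monotonically nonincreasing) on (0,∞). In particular, for batch sizes 0 < b₁ ≤ b₂, the GDP parameter at b₂ is at most the GDP parameter at b₁. -/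
/-- By convexity, the graph of `exp - 1` lies below its chords through the origin. -/
lemma exp_mul_sub_one_le {t : ℝ} (ht₀ : 0 ≤ t) (ht₁ : t ≤ 1) (x : ℝ) :
    Real.exp (t * x) - 1 ≤ t * (Real.exp x - 1) := by
  have h := convexOn_exp.2 (Set.mem_univ x) (Set.mem_univ 0) ht₀ (sub_nonneg.2 ht₁)
    (add_sub_cancel t 1)
  simp only [smul_eq_mul, mul_zero, add_zero, Real.exp_zero, mul_one] at h
  linarith

/-- For every real `a`, the quantity `(exp (a / b ^ 2) - 1) * b ^ 2` does not increase with
`b > 0`. -/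
lemma exp_div_sq_sub_one_mul_sq_le (a : ℝ) {b₁ b₂ : ℝ} (hb₁ : 0 < b₁) (hb : b₁ ≤ b₂) :
    (Real.exp (a / b₂ ^ 2) - 1) * b₂ ^ 2 ≤ (Real.exp (a / b₁ ^ 2) - 1) * b₁ ^ 2 := by
  have hb₂ : 0 < b₂ := hb₁.trans_le hb
  have ht : b₁ ^ 2 / b₂ ^ 2 ≤ 1 := div_le_one_of_le₀ (by gcongr) (by positivity)
  have h := exp_mul_sub_one_le (by positivity) ht (a / b₁ ^ 2)
  have hx : b₁ ^ 2 / b₂ ^ 2 * (a / b₁ ^ 2) = a / b₂ ^ 2 := by field_simp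
  rw [hx, div_mul_eq_mul_div, le_div_iff₀ (by positivity)] at h
  linarith

/-- Larger batch size is more private for DP-SGLD: the map sending the batch size `b`
to the GDP parameter `√(T·(exp(n²·C²/(η·b²)) − 1))·b/n` is antitone on `(0, ∞)`;
in particular, for `0 < b₁ ≤ b₂` the GDP parameter at `b₂` is at most that at `b₁`. -/
theorem dpsgld_larger_batch_more_private
    (T n C η : ℝ) (hT : 0 < T) (hn : 0 < n) (hC : 0 < C) (hη : 0 < η) :
    AntitoneOn (fun b : ℝ =>
        Real.sqrt (T * (Real.exp (n ^ 2 * C ^ 2 / (η * b ^ 2)) - 1)) * b / n)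
      (Set.Ioi (0 : ℝ)) ∧
    ∀ b₁ b₂ : ℝ, 0 < b₁ → b₁ ≤ b₂ →
      Real.sqrt (T * (Real.exp (n ^ 2 * C ^ 2 / (η * b₂ ^ 2)) - 1)) * b₂ / n
        ≤ Real.sqrt (T * (Real.exp (n ^ 2 * C ^ 2 / (η * b₁ ^ 2)) - 1)) * b₁ / n := by
  have key : ∀ b₁ b₂ : ℝ, 0 < b₁ → b₁ ≤ b₂ →
      Real.sqrt (T * (Real.exp (n ^ 2 * C ^ 2 / (η * b₂ ^ 2)) - 1)) * b₂ / n
        ≤ Real.sqrt (T * (Real.exp (n ^ 2 * C ^ 2 / (η * b₁ ^ 2)) - 1)) * b₁ / n := by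
    intro b₁ b₂ hb₁ hb
    have sqrt_mul_eq : ∀ x b : ℝ, 0 < b → Real.sqrt x * b = Real.sqrt (x * b ^ 2) :=
      fun x b hb => by rw [Real.sqrt_mul' x (sq_nonneg b), Real.sqrt_sq hb.le]
    rw [sqrt_mul_eq _ _ hb₁, sqrt_mul_eq _ _ (hb₁.trans_le hb), ← div_div, ← div_div,
      mul_assoc, mul_assoc]
    gcongr Real.sqrt (T * ?_) / n
    exact exp_div_sq_sub_one_mul_sq_le _ hb₁ hb
  exact ⟨fun b₁ hb₁ b₂ _ hb => key b₁ b₂ hb₁ hb, key⟩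
end
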